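/- Let n ≥ 3, let 𝒢_n be the set of simple graphs on {1,…,n}, and for G ∈ 𝒢_n let T₁(G) = e(G)/binom(n,2) and T₂(G) = Δ(G)/binom(n,3). For (θ₁,θ₂) ∈ ℝ² define P_{θ₁,θ₂}(G) = exp(θ₁T₁(G)+θ₂T₂(G))/Z(θ₁,θ₂) with Z(θ₁,θ₂) = Σ_{G∈𝒢_n} exp(θ₁T₁(G)+θ₂T₂(G)). If (θ₁*,θ₂*) satisfies the soft constraints Σ_G T₁(G)P_{θ₁*,θ₂*}(G) = T₁* and Σ_G T₂(G)P_{θ₁*,θ₂*}(G) = T₂*, then θ₁*(T₁* − 1/2) + θ₂*(T₂* − 1/8) ≥ 0. -/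

import Mathlib

open Finset

/-- The number of edges of a simple graph. -/
noncomputable def numEdges {n : ℕ} (G : SimpleGraph (Fin n)) : ℕ :=
  G.edgeSet.ncard

/-- The number of triangles (3-cliques) of a simple graph. -/
noncomputable def numTriangles {n : ℕ} (G : SimpleGraph (Fin n)) : ℕ :=
  {t : Finset (Fin n) | G.IsNClique 3 t}.ncard

/-- The edge density of a simple graph on `n` vertices. -/
noncomputable def edgeDensity {n : ℕ} (G : SimpleGraph (Fin n)) : ℝ :=
  (numEdges G : ℝ) / (n.choose 2 : ℝ)

/-- The triangle density of a simple graph on `n` vertices. -/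
noncomputable def triangleDensity {n : ℕ} (G : SimpleGraph (Fin n)) : ℝ :=
  (numTriangles G : ℝ) / (n.choose 3 : ℝ)

open Classical in
/-- Toggling the edge `ab` shows that exactly half of the graphs satisfying `Q` contain `ab`. -/
lemma half_card {n : ℕ} (a b : Fin n) (hab : a ≠ b) (Q : SimpleGraph (Fin n) → Prop) [DecidablePred Q]
    (hQ : ∀ G, Q (symmDiff G (SimpleGraph.edge a b)) ↔ Q G) :
    2 * (∑ G : SimpleGraph (Fin n), if G.Adj a b ∧ Q G then (1 : ℝ) else 0)
      = ∑ G : SimpleGraph (Fin n), if Q G then (1 : ℝ) else 0 := by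
  have hinv : Function.Involutive
      (fun G : SimpleGraph (Fin n) => symmDiff G (SimpleGraph.edge a b)) := by
    intro G
    simp
  have h := Equiv.sum_comp hinv.toPerm
    (fun G : SimpleGraph (Fin n) => if G.Adj a b ∧ Q G then (1 : ℝ) else 0)
  rw [two_mul]
  nth_rewrite 1 [← h]
  rw [← Finset.sum_add_distrib]
  refine Finset.sum_congr rfl fun G _ => ?_
  have h1 : (symmDiff G (SimpleGraph.edge a b)).Adj a b ↔ ¬ G.Adj a b := by
    simp [symmDiff, SimpleGraph.edge_adj, hab]
  simp only [Function.Involutive.coe_toPerm, hQ, h1]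
  by_cases h2 : G.Adj a b <;> by_cases h3 : Q G <;> simp [h2, h3]

lemma toggle_adj {n : ℕ} (G : SimpleGraph (Fin n)) (a b c d : Fin n)
    (h : s(a, b) ≠ s(c, d)) :
    (symmDiff G (SimpleGraph.edge a b)).Adj c d ↔ G.Adj c d := by
  have : ¬ (SimpleGraph.edge a b).Adj c d := by
    rw [SimpleGraph.edge_adj]
    simp only [ne_eq, Sym2.eq_iff] at h
    tauto
  simp [symmDiff, this]

open Classical in
lemma sum_edge {n : ℕ} (a b : Fin n) (hab : a ≠ b) :
    (∑ G : SimpleGraph (Fin n), if G.Adj a b then (1 : ℝ) else 0)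
      = (1 / 2) * Fintype.card (SimpleGraph (Fin n)) := by
  have := half_card a b hab (fun _ => True) (by simp)
  simp only [and_true, if_true, Finset.sum_const, Finset.card_univ, nsmul_eq_mul, mul_one] at this
  linarith

open Classical in
lemma sum_triangle {n : ℕ} (a b c : Fin n) (hab : a ≠ b) (hac : a ≠ c) (hbc : b ≠ c) :
    (∑ G : SimpleGraph (Fin n), if G.Adj a b ∧ G.Adj a c ∧ G.Adj b c then (1 : ℝ) else 0)
      = (1 / 8) * Fintype.card (SimpleGraph (Fin n)) := by
  have h1 := half_card a b hab (fun G => G.Adj a c ∧ G.Adj b c) (by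
    intro G
    rw [toggle_adj G a b a c (by simp; tauto),
      toggle_adj G a b b c (by simp; tauto)])
  have h2 := half_card a c hac (fun G => G.Adj b c) (by
    intro G
    rw [toggle_adj G a c b c (by simp; tauto)])
  have h3 := sum_edge b c hbc
  linarith

open Classical in
lemma sum_numEdges (n : ℕ) :
    ∑ G : SimpleGraph (Fin n), (numEdges G : ℝ)
      = (n.choose 2 : ℝ) * ((1 / 2) * Fintype.card (SimpleGraph (Fin n))) := by
  have h : ∀ G : SimpleGraph (Fin n), (numEdges G : ℝ)
      = ∑ e ∈ (⊤ : SimpleGraph (Fin n)).edgeFinset, if e ∈ G.edgeSet then (1 : ℝ) else 0 := by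
    intro G
    rw [Finset.sum_boole, numEdges, ← Set.ncard_coe_finset]
    congr 2
    ext e
    simp only [Finset.coe_filter, SimpleGraph.mem_edgeFinset, Set.mem_setOf_eq]
    exact ⟨fun h => ⟨SimpleGraph.edgeSet_mono le_top h, h⟩, fun h => h.2⟩
  simp only [h]
  rw [Finset.sum_comm]
  have : ∀ e ∈ (⊤ : SimpleGraph (Fin n)).edgeFinset,
      (∑ G : SimpleGraph (Fin n), if e ∈ G.edgeSet then (1 : ℝ) else 0)
        = (1 / 2) * Fintype.card (SimpleGraph (Fin n)) := by
    intro e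
    induction e with
    | _ a b =>
      intro he
      simp only [SimpleGraph.mem_edgeFinset, SimpleGraph.mem_edgeSet, SimpleGraph.top_adj] at he
      simpa only [SimpleGraph.mem_edgeSet] using sum_edge a b he
  rw [Finset.sum_congr rfl this, Finset.sum_const, SimpleGraph.card_edgeFinset_top_eq_card_choose_two,
    Fintype.card_fin, nsmul_eq_mul]

open Classical in
lemma sum_numTriangles (n : ℕ) :
    ∑ G : SimpleGraph (Fin n), (numTriangles G : ℝ)
      = (n.choose 3 : ℝ) * ((1 / 8) * Fintype.card (SimpleGraph (Fin n))) := by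
  have h : ∀ G : SimpleGraph (Fin n), (numTriangles G : ℝ)
      = ∑ t ∈ (Finset.univ : Finset (Fin n)).powersetCard 3,
          if G.IsNClique 3 t then (1 : ℝ) else 0 := by
    intro G
    rw [Finset.sum_boole, numTriangles, ← Set.ncard_coe_finset]
    congr 2
    ext t
    simp only [Finset.coe_filter, Finset.mem_powersetCard, Set.mem_setOf_eq]
    exact ⟨fun h => ⟨⟨Finset.subset_univ _, h.card_eq⟩, h⟩, fun h => h.2⟩
  simp only [h]
  rw [Finset.sum_comm]
  have : ∀ t ∈ (Finset.univ : Finset (Fin n)).powersetCard 3,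
      (∑ G : SimpleGraph (Fin n), if G.IsNClique 3 t then (1 : ℝ) else 0)
        = (1 / 8) * Fintype.card (SimpleGraph (Fin n)) := by
    intro t ht
    obtain ⟨a, b, c, hab, hac, hbc, rfl⟩ := Finset.card_eq_three.1 (Finset.mem_powersetCard.1 ht).2
    simpa only [SimpleGraph.is3Clique_triple_iff] using sum_triangle a b c hab hac hbc
  rw [Finset.sum_congr rfl this, Finset.sum_const, Finset.card_powersetCard, Finset.card_univ,
    Fintype.card_fin, nsmul_eq_mul]

/-- The key inequality in the proof of Lemma 4.2 of the paper (Edge-Triangle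
Model): if `(θ₁*, θ₂*)` is the Lagrange multiplier matching the soft
constraints `(T₁*, T₂*)`, then `θ₁*(T₁* − 1/2) + θ₂*(T₂* − 1/8) ≥ 0`. -/
theorem edge_triangle_model_gradient_inequality (n : ℕ) (hn : 3 ≤ n)
    (θ₁star θ₂star T₁star T₂star : ℝ)
    (P : SimpleGraph (Fin n) → ℝ)
    (hP : ∀ G, P G =
        Real.exp (θ₁star * edgeDensity G + θ₂star * triangleDensity G) /
          ∑ G' : SimpleGraph (Fin n),
            Real.exp (θ₁star * edgeDensity G' + θ₂star * triangleDensity G'))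
    (hsoft₁ : ∑ G : SimpleGraph (Fin n), edgeDensity G * P G = T₁star)
    (hsoft₂ : ∑ G : SimpleGraph (Fin n), triangleDensity G * P G = T₂star) :
    0 ≤ θ₁star * (T₁star - 1 / 2) + θ₂star * (T₂star - 1 / 8) := by
  have hc2 : (n.choose 2 : ℝ) ≠ 0 := by
    exact_mod_cast (Nat.choose_pos (by omega : 2 ≤ n)).ne'
  have hc3 : (n.choose 3 : ℝ) ≠ 0 := by
    exact_mod_cast (Nat.choose_pos hn).ne'
  have hE : ∑ G : SimpleGraph (Fin n), edgeDensity G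
      = (1 / 2) * Fintype.card (SimpleGraph (Fin n)) := by
    simp only [edgeDensity]
    rw [← Finset.sum_div, sum_numEdges, mul_div_cancel_left₀ _ hc2]
  have hT : ∑ G : SimpleGraph (Fin n), triangleDensity G
      = (1 / 8) * Fintype.card (SimpleGraph (Fin n)) := by
    simp only [triangleDensity]
    rw [← Finset.sum_div, sum_numTriangles, mul_div_cancel_left₀ _ hc3]
  set Z : ℝ := ∑ G' : SimpleGraph (Fin n),
    Real.exp (θ₁star * edgeDensity G' + θ₂star * triangleDensity G') with hZ
  have hZpos : 0 < Z := Finset.sum_pos (fun _ _ => Real.exp_pos _) Finset.univ_nonempty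
  have hP1 : ∑ G, P G = 1 := by
    simp only [hP]
    rw [← Finset.sum_div, ← hZ, div_self hZpos.ne']
  set c : ℝ := θ₁star * (1 / 2) + θ₂star * (1 / 8) with hc
  let X : SimpleGraph (Fin n) → ℝ :=
    fun G => θ₁star * edgeDensity G + θ₂star * triangleDensity G - c
  have hX0 : ∑ G, X G = 0 := by
    simp only [X, Finset.sum_sub_distrib, Finset.sum_add_distrib, ← Finset.mul_sum, hE, hT,
      Finset.sum_const, Finset.card_univ, nsmul_eq_mul, hc]
    ring
  have hkey : θ₁star * (T₁star - 1 / 2) + θ₂star * (T₂star - 1 / 8) = ∑ G, X G * P G := by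
    have : ∑ G, X G * P G = θ₁star * ∑ G, edgeDensity G * P G
        + θ₂star * ∑ G, triangleDensity G * P G - c * ∑ G, P G := by
      simp only [Finset.mul_sum, ← Finset.sum_add_distrib, ← Finset.sum_sub_distrib]
      exact Finset.sum_congr rfl fun G _ => by simp only [X]; ring
    rw [this, hsoft₁, hsoft₂, hP1, hc]
    ring
  rw [hkey]
  have hle : ∑ G, X G * (Real.exp c / Z) ≤ ∑ G, X G * P G := by
    refine Finset.sum_le_sum fun G _ => ?_
    have hPG : P G = Real.exp (X G) * (Real.exp c / Z) := by
      rw [hP G, ← mul_div_assoc, ← Real.exp_add]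
      simp only [X, sub_add_cancel]
    have hpos : 0 < Real.exp c / Z := div_pos (Real.exp_pos _) hZpos
    rw [hPG, ← mul_assoc]
    refine mul_le_mul_of_nonneg_right ?_ hpos.le
    rcases le_total 0 (X G) with h | h
    · nlinarith [Real.one_le_exp h]
    · nlinarith [Real.exp_le_one_iff.2 h]
  rwa [← Finset.sum_mul, hX0, zero_mul] at hle
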